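/- arXiv:2303.08023 — 4 statements merged into one kernel-verified Lean document; each statement's English description precedes it below -/
import Mathlib

section
/- Let U be an open connected subset of ℝ^d, let y ∈ U, and let x ∈ ℝ^d be a point that is either in U or such that there exist v ∈ ℝ^d and t₀ > 0 with x + s·v ∈ U for all s ∈ (0, t₀] (i.e., x is reachable by running a straight-line flow backward in time from a point of U). Then there exists a continuous piecewise linear path γ : [0, 1] → ℝ^d with γ(0) = x, γ(1) = y, and γ(t) ∈ U for every t ∈ (0, 1]. -/
open Set

def AdmQ {E : Type*} [NormedAddCommGroup E] [NormedSpace ℝ E] (U : Set E) (x y : E) : Prop :=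
  ∃ (N : ℕ) (γ : ℝ → E), 0 < N ∧ Continuous γ ∧ γ 0 = x ∧ γ N = y ∧
    (∀ t ∈ Set.Ioc (0 : ℝ) N, γ t ∈ U) ∧
    ∀ i : ℕ, i < N → ∀ t ∈ Set.Icc (i : ℝ) (i + 1),
      γ t = γ i + (t - i) • (γ (i + 1) - γ i)

theorem AdmQ.base {E : Type*} [NormedAddCommGroup E] [NormedSpace ℝ E] {U : Set E} {x v : E}
    (h : ∀ s ∈ Set.Ioc (0 : ℝ) 1, x + s • v ∈ U) : AdmQ U x (x + v) := by
  refine ⟨1, fun t => x + t • v, one_pos, by fun_prop, by simp, by simp, ?_, ?_⟩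
  · intro t ht
    exact h t (by simpa using ht)
  · intro i hi t ht
    module

theorem AdmQ.step {E : Type*} [NormedAddCommGroup E] [NormedSpace ℝ E] {U : Set E} {x z y : E}
    (hq : AdmQ U x z) (h : ∀ s ∈ Set.Icc (0 : ℝ) 1, z + s • (y - z) ∈ U) : AdmQ U x y := by
  obtain ⟨N, γ, hN, hc, h0, h1, hU, hl⟩ := hq
  have hN' : (0 : ℝ) < N := by exact_mod_cast hN
  obtain ⟨g, hg⟩ : ∃ g : ℝ → E, g = fun t => γ (min t N) + (max (t - N) 0) • (y - z) := ⟨_, rfl⟩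
  have ga : ∀ t : ℝ, t ≤ N → g t = γ t := by
    intro t ht
    simp [hg, min_eq_left ht, max_eq_right (sub_nonpos.2 ht)]
  have gb : ∀ t : ℝ, N ≤ t → g t = z + (t - N) • (y - z) := by
    intro t ht
    simp [hg, min_eq_right ht, max_eq_left (sub_nonneg.2 ht), h1]
  refine ⟨N + 1, g, by omega, by rw [hg]; fun_prop, ?_, ?_, ?_, ?_⟩
  · rw [ga _ hN'.le, h0]
  · rw [gb _ (by push_cast; linarith)]; simp
  · intro t ht
    push_cast at ht
    rcases le_total t N with h' | h'
    · rw [ga _ h']; exact hU t ⟨ht.1, h'⟩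
    · rw [gb _ h']; exact h _ ⟨by linarith, by linarith [ht.2]⟩
  · intro i hi t ht
    rcases Nat.lt_succ_iff_lt_or_eq.1 hi with h' | h'
    · have : (i : ℝ) + 1 ≤ N := by exact_mod_cast h'
      rw [ga _ (ht.2.trans this), ga _ this, ga i (by linarith)]
      exact hl i h' t ht
    · subst h'
      rw [gb _ ht.1, gb _ le_rfl, gb (i + 1) (by linarith)]
      module

theorem AdmQ.all {E : Type*} [NormedAddCommGroup E] [NormedSpace ℝ E] {U : Set E} {x z y : E}
    (ho : IsOpen U) (hc : IsPreconnected U) (hz : z ∈ U) (hy : y ∈ U)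
    (hq : AdmQ U x z) : AdmQ U x y := by
  refine hc.induction₂' (fun a b => AdmQ U x a → AdmQ U x b) ?_ ?_ hz hy hq
  · intro a ha
    obtain ⟨r, hr, hb⟩ := Metric.isOpen_iff.1 ho a ha
    refine mem_nhdsWithin_of_mem_nhds ?_
    filter_upwards [Metric.ball_mem_nhds a hr] with b hbb
    have key : ∀ p ∈ Metric.ball a r, ∀ q ∈ Metric.ball a r, AdmQ U x p → AdmQ U x q := by
      intro p hp q hq' hp'
      refine hp'.step fun s hs => hb ?_
      exact (convex_ball a r).add_smul_sub_mem hp hq' hs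
    exact ⟨key _ (Metric.mem_ball_self hr) _ hbb, key _ hbb _ (Metric.mem_ball_self hr)⟩
  · intro a b c _ _ _ h1 h2 h
    exact h2 (h1 h)

/-- Let `U` be an open connected subset of `ℝ^d`, `y ∈ U`, and let `x`
either be in `U` or be reachable by running a straight-line flow backward in time from
points of `U` (i.e. `x + s • v ∈ U` for all `s ∈ (0, t₀]` for some direction `v` and
`t₀ > 0`).  Then there is a continuous piecewise linear path `γ : [0,1] → ℝ^d` with
`γ 0 = x`, `γ 1 = y` and `γ t ∈ U` for all `t ∈ (0, 1]`. -/
theorem admissible_path_from_exit_boundary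
    {d : ℕ} (U : Set (EuclideanSpace ℝ (Fin d))) (hUopen : IsOpen U)
    (hUconn : IsConnected U) (y : EuclideanSpace ℝ (Fin d)) (hy : y ∈ U)
    (x : EuclideanSpace ℝ (Fin d))
    (hx : x ∈ U ∨ ∃ (v : EuclideanSpace ℝ (Fin d)) (t₀ : ℝ), 0 < t₀ ∧
      ∀ s ∈ Set.Ioc (0 : ℝ) t₀, x + s • v ∈ U) :
    ∃ γ : ℝ → EuclideanSpace ℝ (Fin d),
      ContinuousOn γ (Set.Icc 0 1) ∧ γ 0 = x ∧ γ 1 = y ∧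
      (∀ t ∈ Set.Ioc (0 : ℝ) 1, γ t ∈ U) ∧
      -- piecewise linearity: there is a partition `0 = τ 0 < τ 1 < ⋯ < τ N = 1`
      -- on whose subintervals `γ` is affine
      ∃ (N : ℕ) (τ : Fin (N + 1) → ℝ), StrictMono τ ∧ τ 0 = 0 ∧ τ (Fin.last N) = 1 ∧
        ∀ i : Fin N, ∀ t ∈ Set.Icc (τ i.castSucc) (τ i.succ),
          γ t = γ (τ i.castSucc) +
            ((t - τ i.castSucc) / (τ i.succ - τ i.castSucc)) •
              (γ (τ i.succ) - γ (τ i.castSucc)) := by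
  have hQ : AdmQ U x y := by
    rcases hx with hx | ⟨v, t₀, ht, h⟩
    · have := AdmQ.base (U := U) (x := x) (v := 0) (by simpa using fun _ _ _ => hx)
      rw [add_zero] at this
      exact this.all hUopen hUconn.isPreconnected hx hy
    · have := AdmQ.base (U := U) (x := x) (v := t₀ • v) (by
        intro s hs
        rw [smul_smul]
        exact h _ ⟨mul_pos hs.1 ht, by nlinarith [hs.2]⟩)
      exact this.all hUopen hUconn.isPreconnected (h t₀ ⟨ht, le_rfl⟩) hy
  obtain ⟨N, γ, hN, hc, h0, h1, hU, hl⟩ := hQ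
  have hN' : (0 : ℝ) < N := by exact_mod_cast hN
  have hne : (N : ℝ) ≠ 0 := hN'.ne'
  refine ⟨fun t => γ (N * t), by fun_prop, by simpa using h0, by simpa using h1, ?_, N,
    fun i => (i : ℕ) / (N : ℝ), ?_, by simp, by simp [hne], ?_⟩
  · intro t ht
    exact hU _ ⟨mul_pos hN' ht.1, by nlinarith [ht.2]⟩
  · intro i j hij
    have : ((i : ℕ) : ℝ) < (j : ℕ) := by exact_mod_cast hij
    exact div_lt_div_of_pos_right this hN'
  · intro i t ht
    simp only [Fin.val_castSucc, Fin.val_succ, Nat.cast_add, Nat.cast_one] at ht ⊢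
    have e1 : (N : ℝ) * ((i : ℕ) / N) = (i : ℕ) := by field_simp
    have e2 : (N : ℝ) * (((i : ℕ) + 1) / N) = (i : ℕ) + 1 := by field_simp
    have e3 : (t - (i : ℕ) / (N : ℝ)) / (((i : ℕ) + 1) / (N : ℝ) - (i : ℕ) / N)
        = N * t - (i : ℕ) := by
      rw [← sub_div, add_sub_cancel_left]; field_simp
    rw [e1, e2, e3]
    refine hl i i.2 _ ⟨?_, ?_⟩
    · rw [← e1]; exact mul_le_mul_of_nonneg_left ht.1 hN'.le
    · rw [← e2]; exact mul_le_mul_of_nonneg_left ht.2 hN'.le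
end

section
/- Let Ψ : ℝ^d → ℝ and s : ℝ^d → ℝ be continuously differentiable with s > 0, let v ∈ ℝ^d, and let x : [0, T) → ℝ^d be differentiable with x'(t) = s(x(t))·v for all t ∈ [0, T). Assume that exp(−Ψ(x(u)))·s(x(u)) → 0 as u ↑ T, and let λ : [0, T) → ℝ be a measurable function satisfying λ(t) ≥ max( ⟨v, s(x(t))∇Ψ(x(t)) − ∇s(x(t))⟩, 0 ) for all t. Then lim_{u ↑ T} exp( − ∫₀ᵘ λ(t) dt ) = 0; in other words, an inhomogeneous Poisson event with rate λ occurs before time T with probability one. -/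
open Set MeasureTheory intervalIntegral Filter
open scoped RealInnerProductSpace Topology

/-- (Proposition 2.1 of the paper.)  Along the deterministic flow
`x' (t) = s (x t) • v`, if the weighted density `exp(−Ψ(x u)) s(x u)` vanishes as
`u ↑ T`, then any (locally integrable, measurable) reflection rate `λ` dominating
`max(⟨v, s(x t)∇Ψ(x t) − ∇s(x t)⟩, 0)` satisfies
`lim_{u ↑ T} exp(−∫₀ᵘ λ(t) dt) = 0`: the reflection event occurs before `T` with
probability one. -/
theorem reflect_before_vanishing_boundary
    {d : ℕ} (Ψ s : EuclideanSpace ℝ (Fin d) → ℝ)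
    (hΨ : ContDiff ℝ 1 Ψ) (hs : ContDiff ℝ 1 s) (hspos : ∀ y, 0 < s y)
    (v : EuclideanSpace ℝ (Fin d)) (T : ℝ) (hT : 0 < T)
    (x : ℝ → EuclideanSpace ℝ (Fin d))
    (hx : ∀ t ∈ Set.Ico (0 : ℝ) T, HasDerivAt x (s (x t) • v) t)
    (hvanish : Tendsto (fun u => Real.exp (-Ψ (x u)) * s (x u)) (𝓝[<] T) (𝓝 0))
    (lam : ℝ → ℝ) (hlam : Measurable lam)
    (hlamint : ∀ u ∈ Set.Ico (0 : ℝ) T, IntervalIntegrable lam volume 0 u)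
    (hlam_ge : ∀ t ∈ Set.Ico (0 : ℝ) T,
      max (⟪v, s (x t) • gradient Ψ (x t) - gradient s (x t)⟫) 0 ≤ lam t) :
    Tendsto (fun u => Real.exp (-(∫ t in (0 : ℝ)..u, lam t))) (𝓝[<] T) (𝓝 0) := by
  have hd : ∀ t ∈ Set.Ico (0 : ℝ) T,
      HasDerivAt (fun t => Ψ (x t) - Real.log (s (x t)))
        (⟪v, s (x t) • gradient Ψ (x t) - gradient s (x t)⟫) t := by
    intro t ht
    have h1 : HasFDerivAt Ψ _ (x t) :=
      ((hΨ.differentiable one_ne_zero) (x t)).hasGradientAt.hasFDerivAt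
    have h2 : HasFDerivAt s _ (x t) :=
      ((hs.differentiable one_ne_zero) (x t)).hasGradientAt.hasFDerivAt
    have h3 := h1.comp_hasDerivAt t (hx t ht)
    have h4 := (h2.comp_hasDerivAt t (hx t ht)).log (hspos (x t)).ne'
    have h5 := h3.sub h4
    have hne := (hspos (x t)).ne'
    refine h5.congr_deriv ?_
    simp only [InnerProductSpace.toDual_apply_apply, inner_sub_right, inner_smul_right,
      Function.comp]
    rw [real_inner_comm v (gradient Ψ (x t)), real_inner_comm v (gradient s (x t))]
    field_simp
  have hle : ∀ u ∈ Set.Ico (0 : ℝ) T,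
      (Ψ (x u) - Real.log (s (x u))) - (Ψ (x 0) - Real.log (s (x 0)))
        ≤ ∫ t in (0 : ℝ)..u, lam t := by
    intro u hu
    have hsub : ∀ t ∈ Set.Icc (0 : ℝ) u, t ∈ Set.Ico (0 : ℝ) T :=
      fun t ht => ⟨ht.1, ht.2.trans_lt hu.2⟩
    refine sub_le_integral_of_hasDeriv_right_of_le hu.1
      (g := fun t => Ψ (x t) - Real.log (s (x t)))
      (fun t ht => (hd t (hsub t ht)).continuousAt.continuousWithinAt)
      (fun t ht => (hd t (hsub t ⟨ht.1.le, ht.2.le⟩)).hasDerivWithinAt)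
      ((intervalIntegrable_iff_integrableOn_Icc_of_le hu.1).1 (hlamint u hu))
      (fun t ht => (le_max_left _ _).trans (hlam_ge t (hsub t ⟨ht.1.le, ht.2.le⟩)))
  have hlim := hvanish.mul_const (Real.exp (Ψ (x 0) - Real.log (s (x 0))))
  rw [zero_mul] at hlim
  refine tendsto_of_tendsto_of_tendsto_of_le_of_le' tendsto_const_nhds hlim
    (Eventually.of_forall fun u => (Real.exp_pos _).le) ?_
  filter_upwards [Ico_mem_nhdsLT hT] with u hu
  have h := hle u hu
  calc Real.exp (-(∫ t in (0 : ℝ)..u, lam t))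
      ≤ Real.exp (-Ψ (x u) + Real.log (s (x u)) + (Ψ (x 0) - Real.log (s (x 0)))) :=
        Real.exp_le_exp.2 (by linarith)
    _ = _ := by rw [Real.exp_add, Real.exp_add, Real.exp_log (hspos _)]
end

section
/- Let W and B be open subsets of ℝ^d with B ⊆ W, and let x ∈ ℝ^d. Define V = { v ∈ ℝ^d : there exists t > 0 such that x + t·v ∈ B and x + s·v ∈ W for all s ∈ [0, t] }. Then V is an open subset of ℝ^d; consequently, if V is nonempty it has positive Lebesgue measure, and ρ(V) > 0 for any measure ρ on ℝ^d having a continuous strictly positive density with respect to Lebesgue measure. -/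
open MeasureTheory Set

/-- (Lemma A.4 of the paper, geometric core.)  Let `W, B ⊆ ℝ^d` be
open with `B ⊆ W` and `x ∈ ℝ^d`.  The set `V` of velocities `v` for which the straight
line `s ↦ x + s • v` enters `B` at some time `t > 0` while staying in `W` on `[0, t]`
is open; consequently, if `V` is nonempty it has positive Lebesgue measure, and
`ρ(V) > 0` for any measure `ρ` with continuous strictly positive Lebesgue density. -/
theorem velocity_set_open_and_positive_measure
    {d : ℕ} (W B : Set (EuclideanSpace ℝ (Fin d)))
    (hW : IsOpen W) (hB : IsOpen B) (hBW : B ⊆ W)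
    (x : EuclideanSpace ℝ (Fin d))
    (V : Set (EuclideanSpace ℝ (Fin d)))
    (hV : V = {v | ∃ t : ℝ, 0 < t ∧ x + t • v ∈ B ∧
      ∀ s ∈ Set.Icc (0 : ℝ) t, x + s • v ∈ W}) :
    IsOpen V ∧
    (V.Nonempty → 0 < volume V) ∧
    ∀ g : EuclideanSpace ℝ (Fin d) → ℝ, Continuous g → (∀ v, 0 < g v) →
      V.Nonempty → 0 < (volume.withDensity fun v => ENNReal.ofReal (g v)) V := by
  have hopen : IsOpen V := by
    rw [hV, isOpen_iff_mem_nhds]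
    rintro v ⟨t, ht, htB, htW⟩
    have h1 : ∀ᶠ u in nhds v, x + t • u ∈ B := by
      have hc : Continuous fun u : EuclideanSpace ℝ (Fin d) => x + t • u := by fun_prop
      exact hc.continuousAt.eventually_mem (hB.mem_nhds htB)
    have h2 : ∀ᶠ u in nhds v, ∀ s ∈ Set.Icc (0 : ℝ) t, x + s • u ∈ W := by
      apply isCompact_Icc.eventually_forall_of_forall_eventually
      intro s hs
      have hc : Continuous fun p : EuclideanSpace ℝ (Fin d) × ℝ => x + p.2 • p.1 := by fun_prop
      exact (hc.continuousAt (x := (v, s))).eventually_mem (hW.mem_nhds (htW s hs))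
    filter_upwards [h1, h2] with u hu1 hu2
    exact ⟨t, ht, hu1, hu2⟩
  refine ⟨hopen, fun hne => hopen.measure_pos volume hne, fun g hg hpos hne => ?_⟩
  rw [pos_iff_ne_zero]
  intro h0
  rw [withDensity_apply_eq_zero (by fun_prop)] at h0
  have he : {v | ENNReal.ofReal (g v) ≠ 0} ∩ V = V := by
    apply Set.inter_eq_right.mpr
    intro v _
    simpa using hpos v
  rw [he] at h0
  exact (hopen.measure_pos volume hne).ne' h0
end

section
/- Let β : [0, ∞) → [0, ∞) be measurable and locally integrable, set B(t) = ∫₀ᵗ β(s) ds, and assume B(t) → ∞ as t → ∞, so that g(t) = β(t) exp(−B(t)) for t ≥ 0 is a probability density. Let X have density g and let σ ≥ 0 be independent of X with continuous cumulative distribution function F. Then for every T > 0 the event {X + σ ≥ T} has probability P(X + σ ≥ T) = ∫₀^T β(r) exp(−B(r)) (1 − F(T − r)) dr + exp(−B(T)) > 0, and for all 0 ≤ t < T: P( X ≤ t | X + σ ≥ T ) = ( ∫₀ᵗ β(r) exp(−B(r)) (1 − F(T − r)) dr ) / ( ∫₀^T β(r) exp(−B(r)) (1 − F(T − r)) dr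 + exp(−B(T)) ). -/
open MeasureTheory ProbabilityTheory intervalIntegral


lemma aux_B_cont (β : ℝ → ℝ) (hβloc : ∀ a : ℝ, IntervalIntegrable β volume 0 a)
    (B : ℝ → ℝ) (hB : ∀ a, B a = ∫ s in (0 : ℝ)..a, β s) : Continuous B := by
  have : B = fun a => ∫ s in (0 : ℝ)..a, β s := funext hB
  rw [this]
  exact intervalIntegral.continuous_primitive
    (fun a b => (hβloc a).symm.trans (hβloc b)) 0

lemma aux_B_nonneg (β : ℝ → ℝ) (hβ0 : ∀ s, 0 ≤ s → 0 ≤ β s)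
    (B : ℝ → ℝ) (hB : ∀ a, B a = ∫ s in (0 : ℝ)..a, β s) (x : ℝ) (hx : 0 ≤ x) : 0 ≤ B x := by
  rw [hB]
  exact intervalIntegral.integral_nonneg hx (fun u hu => hβ0 u hu.1)

lemma aux_exp_lip (x y : ℝ) (hx : 0 ≤ x) (hy : 0 ≤ y) :
    dist (Real.exp (-x)) (Real.exp (-y)) ≤ dist x y := by
  wlog h : x ≤ y generalizing x y
  · rw [dist_comm, dist_comm x y]; exact this y x hy hx (le_of_not_ge h)
  rw [Real.dist_eq, Real.dist_eq, abs_sub_comm x y, abs_of_nonneg (sub_nonneg.2 h),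
    abs_of_nonneg (sub_nonneg.2 (Real.exp_le_exp.2 (by linarith)))]
  have h1 : Real.exp (-y) = Real.exp (-x) * Real.exp (-(y - x)) := by
    rw [← Real.exp_add]; congr 1; ring
  have h2 := Real.add_one_le_exp (-(y - x))
  have h3 : Real.exp (-x) ≤ 1 := Real.exp_le_one_iff.2 (by linarith)
  have h4 := Real.exp_pos (-x)
  rw [h1]
  nlinarith

lemma aux_ftc (β : ℝ → ℝ) (hβ0 : ∀ s, 0 ≤ s → 0 ≤ β s)
    (hβloc : ∀ a : ℝ, IntervalIntegrable β volume 0 a)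
    (B : ℝ → ℝ) (hB : ∀ a, B a = ∫ s in (0 : ℝ)..a, β s) (T : ℝ) (hT : 0 < T) :
    ∫ r in (0 : ℝ)..T, β r * Real.exp (-B r) = 1 - Real.exp (-B T) := by
  have hBf : B = fun a => ∫ s in (0 : ℝ)..a, β s := funext hB
  have hac : AbsolutelyContinuousOnInterval B 0 T := by
    rw [hBf]
    exact (hβloc T).absolutelyContinuousOnInterval_intervalIntegral (by simp)
  have hac2 : AbsolutelyContinuousOnInterval (fun x => Real.exp (-B x)) 0 T := by
    rw [absolutelyContinuousOnInterval_iff] at hac ⊢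
    intro ε hε
    obtain ⟨δ, hδ, h⟩ := hac ε hε
    refine ⟨δ, hδ, fun E hE hs => lt_of_le_of_lt (Finset.sum_le_sum fun i hi => ?_) (h E hE hs)⟩
    have := hE.1 i hi
    rw [Set.uIcc_of_le hT.le] at this
    exact aux_exp_lip _ _ (aux_B_nonneg β hβ0 B hB _ this.1.1) (aux_B_nonneg β hβ0 B hB _ this.2.1)
  have h1 := hac2.integral_deriv_eq_sub
  have h2 : ∫ x in (0 : ℝ)..T, deriv (fun x => Real.exp (-B x)) x
      = ∫ x in (0 : ℝ)..T, -(β x * Real.exp (-B x)) := by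
    apply intervalIntegral.integral_congr_ae
    filter_upwards [(hβloc T).ae_hasDerivAt_integral] with x hx hx2
    have hd : HasDerivAt B (β x) x := by
      rw [hBf]
      exact hx (Set.uIoc_subset_uIcc hx2) 0 (by simp)
    refine (hd.fun_neg.exp.deriv).trans ?_
    ring
  have hB0 : B 0 = 0 := by rw [hB]; simp
  rw [h2, intervalIntegral.integral_neg, hB0] at h1
  simp at h1
  linarith

lemma aux_lint (β : ℝ → ℝ) (hβm : Measurable β) (hβ0 : ∀ s, 0 ≤ s → 0 ≤ β s)
    (hβloc : ∀ a : ℝ, IntervalIntegrable β volume 0 a)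
    (B : ℝ → ℝ) (hB : ∀ a, B a = ∫ s in (0 : ℝ)..a, β s) (t : ℝ) (ht : 0 ≤ t)
    (H : ℝ → ℝ) (hH : Continuous H) (hH0 : ∀ x, 0 ≤ H x) :
    ∫⁻ x, (Set.Iic t).indicator (fun x => ENNReal.ofReal (H x)) x
      ∂(volume.withDensity fun r =>
        ENNReal.ofReal (if 0 ≤ r then β r * Real.exp (-B r) else 0)) =
    ENNReal.ofReal (∫ r in (0 : ℝ)..t, β r * Real.exp (-B r) * H r) := by
  have hBc := aux_B_cont β hβloc B hB
  rw [lintegral_withDensity_eq_lintegral_mul]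
  rotate_left
  · exact (Measurable.ite measurableSet_Ici (by fun_prop) measurable_const).ennreal_ofReal
  · exact (hH.measurable.ennreal_ofReal).indicator measurableSet_Iic
  have hint : IntervalIntegrable (fun r => β r * Real.exp (-B r) * H r) volume 0 t := by
    simp_rw [mul_assoc]
    exact (hβloc t).mul_continuousOn (by fun_prop)
  rw [intervalIntegral.integral_of_le ht, ofReal_integral_eq_lintegral_ofReal
    ((intervalIntegrable_iff_integrableOn_Ioc_of_le ht).1 hint), ← setLIntegral_congr
    (Ioc_ae_eq_Icc (a := (0:ℝ)) (b := t)).symm, ← lintegral_indicator measurableSet_Icc]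
  · congr 1
    ext x
    by_cases h0 : 0 ≤ x <;> by_cases h1 : x ≤ t <;>
      simp [Set.indicator, h0, h1, ENNReal.ofReal_mul', hH0]
  · filter_upwards [ae_restrict_mem measurableSet_Ioc] with x hx
    exact mul_nonneg (mul_nonneg (hβ0 x hx.1.le) (Real.exp_pos _).le) (hH0 x)

lemma aux_tail {Ω : Type*} [MeasureSpace Ω] [IsProbabilityMeasure (ℙ : Measure Ω)]
    (σ : Ω → ℝ) (hσm : Measurable σ)
    (F : ℝ → ℝ) (hF : ∀ a, F a = (ℙ {ω | σ ω ≤ a}).toReal) (hFc : Continuous F) (a : ℝ) :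
    (Measure.map σ ℙ) (Set.Ici a) = ENNReal.ofReal (1 - F a) := by
  have : IsProbabilityMeasure (Measure.map σ ℙ) := Measure.isProbabilityMeasure_map hσm.aemeasurable
  have hcdf : (fun x => cdf (Measure.map σ ℙ) x) = F := by
    ext x
    rw [cdf_eq_real, hF, measureReal_def, Measure.map_apply hσm measurableSet_Iic]
    rfl
  have hl : Function.leftLim (cdf (Measure.map σ ℙ)) a = F a := by
    have h : ((cdf (Measure.map σ ℙ) : StieltjesFunction ℝ) : ℝ → ℝ) = F := hcdf
    rw [h]
    exact hFc.continuousAt.continuousWithinAt.leftLim_eq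
  rw [← measure_cdf (Measure.map σ ℙ), StieltjesFunction.measure_Ici _ (tendsto_cdf_atTop _), hl]

/-- (Appendix B.1, equation (3.3) of the paper.)  Let `X` be the
first event of an inhomogeneous Poisson process with locally integrable rate `β`, i.e.
`X` has density `g(t) = β(t) exp(−B(t))` on `[0, ∞)` where `B(t) = ∫₀ᵗ β`, and assume
`B(t) → ∞`.  Let `σ ≥ 0` be independent of `X` with continuous cdf `F`.  Then for
`T > 0` the probability of no notification before `T` equals
`∫₀^T β(r) e^{−B(r)} (1 − F(T−r)) dr + e^{−B(T)} > 0`, and for `0 ≤ t < T`,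
`P(X ≤ t ∣ X + σ ≥ T)` equals the stated ratio. -/
theorem conditional_infection_time_law
    {Ω : Type*} [MeasureSpace Ω] [IsProbabilityMeasure (ℙ : Measure Ω)]
    (β : ℝ → ℝ) (hβm : Measurable β) (hβ0 : ∀ s, 0 ≤ s → 0 ≤ β s)
    (hβloc : ∀ a : ℝ, IntervalIntegrable β volume 0 a)
    (B : ℝ → ℝ) (hB : ∀ a, B a = ∫ s in (0 : ℝ)..a, β s)
    (hBtop : Filter.Tendsto B Filter.atTop Filter.atTop)
    (X σ : Ω → ℝ) (hXm : Measurable X) (hσm : Measurable σ)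
    (hindep : IndepFun X σ) (hσ0 : ∀ ω, 0 ≤ σ ω)
    (hdens : Measure.map X ℙ = volume.withDensity fun r =>
      ENNReal.ofReal (if 0 ≤ r then β r * Real.exp (-B r) else 0))
    (F : ℝ → ℝ) (hF : ∀ a, F a = (ℙ {ω | σ ω ≤ a}).toReal) (hFc : Continuous F)
    (T : ℝ) (hT : 0 < T) :
    ℙ {ω | T ≤ X ω + σ ω} =
      ENNReal.ofReal
        ((∫ r in (0 : ℝ)..T, β r * Real.exp (-B r) * (1 - F (T - r)))
          + Real.exp (-B T)) ∧
    0 < ℙ {ω | T ≤ X ω + σ ω} ∧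
    ∀ t : ℝ, 0 ≤ t → t < T →
      (ℙ[|{ω | T ≤ X ω + σ ω}]) {ω | X ω ≤ t} =
        ENNReal.ofReal
          ((∫ r in (0 : ℝ)..t, β r * Real.exp (-B r) * (1 - F (T - r))) /
            ((∫ r in (0 : ℝ)..T, β r * Real.exp (-B r) * (1 - F (T - r)))
              + Real.exp (-B T))) := by
  have hF0 : ∀ x, 0 ≤ 1 - F (T - x) := by
    intro x
    rw [hF, sub_nonneg]
    exact ENNReal.toReal_le_of_le_ofReal zero_le_one (by simpa using prob_le_one)
  have hS : MeasurableSet {ω | T ≤ X ω + σ ω} := measurableSet_le measurable_const (hXm.add hσm)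
  have hXt : ∀ t, MeasurableSet {ω | X ω ≤ t} := fun t => measurableSet_le hXm measurable_const
  have key : ∀ t, 0 ≤ t → ℙ ({ω | T ≤ X ω + σ ω} ∩ {ω | X ω ≤ t}) =
      ENNReal.ofReal (∫ r in (0 : ℝ)..t, β r * Real.exp (-B r) * (1 - F (T - r))) := by
    intro t ht
    rw [← aux_lint β hβm hβ0 hβloc B hB t ht (fun r => 1 - F (T - r)) (by fun_prop) hF0, ← hdens]
    have hm : MeasurableSet {p : ℝ × ℝ | T ≤ p.1 + p.2 ∧ p.1 ≤ t} :=
      (measurableSet_le measurable_const (measurable_fst.add measurable_snd)).inter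
        (measurableSet_le measurable_fst measurable_const)
    have : IsProbabilityMeasure (Measure.map σ ℙ) :=
      Measure.isProbabilityMeasure_map hσm.aemeasurable
    have e1 : ℙ ({ω | T ≤ X ω + σ ω} ∩ {ω | X ω ≤ t}) =
        (Measure.map (fun ω => (X ω, σ ω)) ℙ) {p : ℝ × ℝ | T ≤ p.1 + p.2 ∧ p.1 ≤ t} := by
      rw [Measure.map_apply (hXm.prodMk hσm) hm]; rfl
    rw [e1, (indepFun_iff_map_prod_eq_prod_map_map hXm.aemeasurable hσm.aemeasurable).1 hindep,
      Measure.prod_apply hm]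
    congr 1
    ext x
    by_cases hx : x ≤ t
    · rw [Set.indicator_of_mem (show x ∈ Set.Iic t from hx), ← aux_tail σ hσm F hF hFc]
      congr 1
      ext y
      simp [hx, add_comm]
    · rw [Set.indicator_of_notMem (show x ∉ Set.Iic t from hx)]
      simp [hx]
  have hXT : ℙ {ω | X ω ≤ T} = ENNReal.ofReal (1 - Real.exp (-B T)) := by
    have h := aux_lint β hβm hβ0 hβloc B hB T hT.le (fun _ => 1) continuous_const
      (fun _ => zero_le_one)
    simp only [mul_one] at h
    rw [aux_ftc β hβ0 hβloc B hB T hT, ← hdens] at h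
    rw [← h, ENNReal.ofReal_one, lintegral_indicator measurableSet_Iic, setLIntegral_const, one_mul,
      Measure.map_apply hXm measurableSet_Iic]
    rfl
  have hBT : Real.exp (-B T) ≤ 1 :=
    Real.exp_le_one_iff.2 (by linarith [aux_B_nonneg β hβ0 B hB T hT.le])
  have hI0 : 0 ≤ ∫ r in (0 : ℝ)..T, β r * Real.exp (-B r) * (1 - F (T - r)) :=
    intervalIntegral.integral_nonneg hT.le fun u hu =>
      mul_nonneg (mul_nonneg (hβ0 u hu.1) (Real.exp_pos _).le) (hF0 u)
  have main : ℙ {ω | T ≤ X ω + σ ω} =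
      ENNReal.ofReal
        ((∫ r in (0 : ℝ)..T, β r * Real.exp (-B r) * (1 - F (T - r)))
          + Real.exp (-B T)) := by
    rw [← measure_inter_add_diff _ (hXt T), key T hT.le, ENNReal.ofReal_add hI0 (Real.exp_pos _).le]
    congr 1
    have : {ω | T ≤ X ω + σ ω} \ {ω | X ω ≤ T} = {ω | X ω ≤ T}ᶜ := by
      ext ω
      simp only [Set.mem_diff, Set.mem_setOf_eq, Set.mem_compl_iff, not_le]
      constructor
      · exact fun h => h.2
      · exact fun h => ⟨by linarith [hσ0 ω], h⟩
    rw [this, prob_compl_eq_one_sub (hXt T), hXT, ← ENNReal.ofReal_one,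
      ← ENNReal.ofReal_sub _ (by linarith)]
    congr 1; ring
  have hpos : 0 < (∫ r in (0 : ℝ)..T, β r * Real.exp (-B r) * (1 - F (T - r)))
          + Real.exp (-B T) := by positivity
  refine ⟨main, ?_, ?_⟩
  · rw [main]; exact ENNReal.ofReal_pos.2 hpos
  · intro t ht htT
    rw [cond_apply hS, key t ht, main, ENNReal.ofReal_div_of_pos hpos, ENNReal.div_eq_inv_mul]
end
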